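/- Let 0 < D₁ < D₂ < β′ < β and assume (D₁, D₂) ∩ σ(H̃(η)) = ∅ for all η ∈ [0, ε₁]. Set D := (sup_{η ∈ [0,ε₁]} ‖H(η)Π(η)‖²) · (β′)² · β⁻³. If D < (D₂ − D₁)/2, then for every η ∈ [0, ε₁] the open interval (D₁ + D, D₂ − D) is disjoint from σ(H(η)). -/

import Mathlib

noncomputable section

open MeasureTheory
open scoped ComplexOrder

/-- The abstract Feshbach–Schur setup: a densely defined nonnegative self-adjoint operator `H`,
an orthogonal projection `P` (denoted `Π`) with range in the domain of `H`, a bounded operator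
`T = HΠ`, and a lower bound `Π⊥ H Π⊥ ≥ 2β Π⊥`. -/
structure FeshbachSetup (ℋ : Type*) [NormedAddCommGroup ℋ] [InnerProductSpace ℂ ℋ]
    [CompleteSpace ℋ] (β : ℝ) : Type _ where
  H : ℋ →ₗ.[ℂ] ℋ
  dense_dom : Dense (H.domain : Set ℋ)
  selfAdjoint : IsSelfAdjoint H
  nonneg : ∀ u : H.domain, 0 ≤ (inner ℂ (u : ℋ) (H u) : ℂ)
  P : ℋ →L[ℂ] ℋ
  P_idem : P.comp P = P
  P_sa : ContinuousLinearMap.adjoint P = P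
  memP : ∀ x : ℋ, P x ∈ H.domain
  T : ℋ →L[ℂ] ℋ
  T_eq : ∀ x : ℋ, T x = H ⟨P x, memP x⟩
  β_pos : 0 < β
  lower : ∀ u : H.domain,
    ((2 * β * ‖(u : ℋ) - P u‖ ^ 2 : ℝ) : ℂ) ≤
      inner ℂ ((u : ℋ) - P u) (H ⟨(u : ℋ) - P u, H.domain.sub_mem u.2 (memP u)⟩)

namespace FeshbachSetup

variable {ℋ : Type*} [NormedAddCommGroup ℋ] [InnerProductSpace ℂ ℋ] [CompleteSpace ℋ]
variable {β : ℝ} (S : FeshbachSetup ℋ β)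

/-- `R` witnesses that `H - E` is a bijection from the domain of `H` onto `ℋ`
with bounded inverse `R`. -/
def IsInvWitness (E : ℝ) (R : ℋ →L[ℂ] ℋ) : Prop :=
  (∀ u : S.H.domain, R (S.H u - (E : ℂ) • (u : ℋ)) = u) ∧
  (∀ y : ℋ, ∃ h : R y ∈ S.H.domain, S.H ⟨R y, h⟩ - (E : ℂ) • R y = y)

/-- `H - E` is a bijection from the domain of `H` onto `ℋ` with bounded inverse. -/
def IsInvertibleAt (E : ℝ) : Prop := ∃ R, S.IsInvWitness E R

/-- the spectrum `σ(H)` (as a subset of `ℝ`). -/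
def spec : Set ℝ := {E | ¬ S.IsInvertibleAt E}

/-- the bounded operator `Π⊥ H Π`. -/
def A : ℋ →L[ℂ] ℋ := (1 - S.P).comp S.T

/-- `R : ℝ → 𝓛(ℋ)` is the family of reduced resolvents `E ↦ R⊥(E)`:  for `E ∈ [0, 2β)`,
`R E` is supported on `Π⊥ℋ` and is there a two-sided inverse of `Π⊥(H - E)Π⊥`. -/
def IsRedResolvent (R : ℝ → (ℋ →L[ℂ] ℋ)) : Prop :=
  ∀ E ∈ Set.Ico (0 : ℝ) (2 * β),
    ((1 - S.P).comp ((R E).comp (1 - S.P)) = R E) ∧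
    (∀ u : S.H.domain,
      R E ((1 - S.P)
          (S.H ⟨(u : ℋ) - S.P u, S.H.domain.sub_mem u.2 (S.memP u)⟩
            - (E : ℂ) • ((u : ℋ) - S.P u)))
        = (u : ℋ) - S.P u) ∧
    (∀ y : ℋ, ∃ h : R E y ∈ S.H.domain,
      (1 - S.P) (S.H ⟨R E y, h⟩ - (E : ℂ) • R E y) = (1 - S.P) y)

/-- `Y = Π + ΠHΠ⊥ R⊥(0)² Π⊥HΠ`, as an operator on `ℋ` vanishing on `Π⊥ℋ`. -/
def Y (R : ℝ → (ℋ →L[ℂ] ℋ)) : ℋ →L[ℂ] ℋ :=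
  S.P + (ContinuousLinearMap.adjoint S.A).comp ((R 0).comp ((R 0).comp S.A))

/-- `G` is `Y^{-1/2} ∈ 𝓛(Πℋ)`, extended by `0` on `Π⊥ℋ`:  `G` is supported on `Πℋ`,
self-adjoint, nonnegative, and `G Y G = Π`. -/
def IsYInvSqrt (R : ℝ → (ℋ →L[ℂ] ℋ)) (G : ℋ →L[ℂ] ℋ) : Prop :=
  S.P.comp (G.comp S.P) = G ∧
  ContinuousLinearMap.adjoint G = G ∧
  (∀ x : ℋ, 0 ≤ (inner ℂ x (G x) : ℂ)) ∧
  G.comp ((S.Y R).comp G) = S.P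

/-- the dressed operator `H̃ = Y^{-1/2}[ΠHΠ - ΠHΠ⊥R⊥(0)Π⊥HΠ]Y^{-1/2}`,
extended by `0` on `Π⊥ℋ`. -/
def Htilde (R : ℝ → (ℋ →L[ℂ] ℋ)) (G : ℋ →L[ℂ] ℋ) : ℋ →L[ℂ] ℋ :=
  G.comp (((S.P.comp S.T) - (ContinuousLinearMap.adjoint S.A).comp ((R 0).comp S.A)).comp G)

end FeshbachSetup

/-- `V` is a two-sided inverse of `W` in the corner algebra `Π 𝓛(ℋ) Π` (with unit `P`),
i.e. `W` viewed as an operator on `Πℋ` is invertible with inverse `V`. -/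
def IsCornerInv {ℋ : Type*} [NormedAddCommGroup ℋ] [InnerProductSpace ℂ ℋ]
    (P W V : ℋ →L[ℂ] ℋ) : Prop :=
  P.comp (V.comp P) = V ∧ V.comp W = P ∧ W.comp V = P

/-- the spectrum of an operator `W` supported on `Πℋ`, viewed as a bounded operator
on `Πℋ` (as a subset of `ℝ`). -/
def cornerSpec {ℋ : Type*} [NormedAddCommGroup ℋ] [InnerProductSpace ℂ ℋ]
    (P W : ℋ →L[ℂ] ℋ) : Set ℝ :=
  {E : ℝ | ¬ ∃ V, IsCornerInv P (W - (E : ℂ) • P) V}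

section CornerAlg

variable {𝓐 : Type*} [CStarAlgebra 𝓐]

theorem corner_norm_le {P W V : 𝓐} {δ : ℝ} (hδ : 0 < δ)
    (hVW : V * W = P) (hWV : W * V = P) (hVP : V * P = V)
    (hVs : IsSelfAdjoint V)
    (h : ∀ t : ℝ, |t| < δ → ∃ V', P * V' = V' ∧ V' * P = V' ∧ V' * (W - (t : ℂ) • P) = P ∧
      (W - (t : ℂ) • P) * V' = P) : ‖V‖ ≤ δ⁻¹ := by
  have key : ∀ z ∈ spectrum ℂ V, ‖z‖ ≤ δ⁻¹ := by
    intro z hz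
    by_contra hlt
    push Not at hlt
    have hre := hVs.mem_spectrum_eq_re hz
    set m : ℝ := z.re with hm
    have hmabs : ‖z‖ = |m| := by rw [hre, Complex.norm_real, Real.norm_eq_abs]
    rw [hmabs] at hlt
    have hmpos : 0 < |m| := lt_trans (by positivity) hlt
    have hm0 : (m : ℂ) ≠ 0 := by exact_mod_cast abs_pos.mp hmpos
    obtain ⟨V', h1, h2, h3, h4⟩ := h m⁻¹ (by rw [abs_inv]; exact inv_lt_of_inv_lt₀ hδ hlt)
    rw [hre] at hz
    apply hz
    push_cast at h3 h4
    rw [spectrum.mem_resolventSet_iff, Algebra.algebraMap_eq_smul_one]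
    rw [mul_sub, mul_smul_comm, h2] at h3
    rw [sub_mul, smul_mul_assoc, h1] at h4
    have e1 : V' * W = P + (m : ℂ)⁻¹ • V' := by rw [← h3]; abel
    have e2 : W * V' = P + (m : ℂ)⁻¹ • V' := by rw [← h4]; abel
    have e3 : V * V' = V' * V := by
      have : V * (W * V') * V = V * (V' * W) * V := by rw [e1, e2]
      rw [← mul_assoc V W, hVW, h1, mul_assoc V, mul_assoc V', hWV, h2] at this
      exact this.symm
    have e4 : V * V' = (m : ℂ) • (V' - V) := by
      have : V * (W * V') = V * (P + (m : ℂ)⁻¹ • V') := by rw [e2]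
      rw [← mul_assoc, hVW, h1, mul_add, hVP, mul_smul_comm] at this
      have h5 : V' - V = (m : ℂ)⁻¹ • (V * V') := sub_eq_of_eq_add' this
      rw [h5, smul_smul, mul_inv_cancel₀ hm0, one_smul]
    set c : ℂ := (m : ℂ) with hc
    have e5 : c⁻¹ • (c • (V' - V)) = V' - V := by
      rw [smul_smul, inv_mul_cancel₀ hm0, one_smul]
    refine ⟨⟨c • 1 - V, c⁻¹ • 1 + (c⁻¹ * c⁻¹) • V', ?_, ?_⟩, rfl⟩
    · have : (c • (1 : 𝓐) - V) * (c⁻¹ • 1 + (c⁻¹ * c⁻¹) • V')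
          = 1 + c⁻¹ • (V' - V) - (c⁻¹ * c⁻¹) • (V * V') := by
        simp only [sub_mul, mul_add, smul_mul_assoc, mul_smul_comm, one_mul, mul_one]
        match_scalars <;> field_simp
      rw [this, e4, smul_smul, mul_assoc, inv_mul_cancel₀ hm0, mul_one]; abel
    · have : (c⁻¹ • 1 + (c⁻¹ * c⁻¹) • V') * (c • (1 : 𝓐) - V)
          = 1 + c⁻¹ • (V' - V) - (c⁻¹ * c⁻¹) • (V * V') := by
        rw [e3]
        simp only [mul_sub, add_mul, smul_mul_assoc, mul_smul_comm, one_mul, mul_one]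
        match_scalars <;> field_simp
      rw [this, e4, smul_smul, mul_assoc, inv_mul_cancel₀ hm0, mul_one]; abel
  have hr := hVs.spectralRadius_eq_nnnorm
  have hle : spectralRadius ℂ V ≤ ENNReal.ofReal δ⁻¹ := by
    refine iSup₂_le fun z hz => ?_
    rw [← ENNReal.ofReal_coe_nnreal]
    exact ENNReal.ofReal_le_ofReal (key z hz)
  rw [hr, ← ENNReal.ofReal_coe_nnreal, ENNReal.ofReal_le_ofReal_iff (by positivity)] at hle
  exact hle

end CornerAlg

namespace FeshbachSetup

variable {ℋ : Type*} [NormedAddCommGroup ℋ] [InnerProductSpace ℂ ℋ] [CompleteSpace ℋ]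
variable {β : ℝ} (S : FeshbachSetup ℋ β)

theorem symm (x y : S.H.domain) : inner ℂ (S.H x) (y : ℋ) = inner ℂ (x : ℋ) (S.H y) := by
  have h := LinearPMap.adjoint_isFormalAdjoint S.dense_dom
  rw [LinearPMap.isSelfAdjoint_def.mp S.selfAdjoint] at h
  exact h x y

theorem PP (x : ℋ) : S.P (S.P x) = S.P x := congrArg (fun f => f x) S.P_idem

theorem P_symm (x y : ℋ) : inner ℂ (S.P x) y = inner ℂ x (S.P y) := by
  conv_lhs => rw [← S.P_sa]
  exact ContinuousLinearMap.adjoint_inner_left _ _ _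

theorem TP (x : ℋ) : S.T (S.P x) = S.T x := by
  rw [S.T_eq, S.T_eq]; congr 1; exact Subtype.ext (S.PP x)

theorem norm_P_sq (x : ℋ) : ‖S.P x‖ ^ 2 + ‖x - S.P x‖ ^ 2 = ‖x‖ ^ 2 := by
  have h0 : inner ℂ (S.P x) (x - S.P x) = 0 := by
    rw [P_symm, map_sub, S.PP, sub_self, inner_zero_right]
  have := norm_add_sq_eq_norm_sq_add_norm_sq_of_inner_eq_zero (𝕜 := ℂ) (S.P x) (x - S.P x) h0
  rw [add_sub_cancel] at this
  nlinarith

theorem norm_P_le (x : ℋ) : ‖S.P x‖ ≤ ‖x‖ := by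
  have := S.norm_P_sq x
  exact abs_le_of_sq_le_sq' (by nlinarith [sq_nonneg ‖x - S.P x‖]) (norm_nonneg _) |>.2

theorem norm_Q_le (x : ℋ) : ‖x - S.P x‖ ≤ ‖x‖ := by
  have := S.norm_P_sq x
  exact abs_le_of_sq_le_sq' (by nlinarith [sq_nonneg ‖S.P x‖]) (norm_nonneg _) |>.2

theorem A_apply (x : ℋ) : S.A x = S.T x - S.P (S.T x) := rfl

theorem norm_A_le : ‖S.A‖ ≤ ‖S.T‖ := by
  refine ContinuousLinearMap.opNorm_le_bound _ (norm_nonneg _) fun x => ?_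
  rw [A_apply]
  exact (S.norm_Q_le _).trans (S.T.le_opNorm x)

theorem PT_symm (x y : ℋ) : inner ℂ (S.P (S.T x)) y = inner ℂ x (S.P (S.T y)) := by
  rw [P_symm, ← P_symm S x, S.T_eq x, S.T_eq y]
  exact S.symm ⟨S.P x, S.memP x⟩ ⟨S.P y, S.memP y⟩

section Res
variable {S} {R : ℝ → (ℋ →L[ℂ] ℋ)} (hR : S.IsRedResolvent R) {E : ℝ} (hE : E ∈ Set.Ico 0 (2 * β))
include hR hE

theorem PR (x : ℋ) : S.P (R E x) = 0 := by
  have := congrArg (fun f => S.P (f x)) (hR E hE).1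
  simp only [ContinuousLinearMap.comp_apply, sub_apply,
    one_apply_eq_self, map_sub, S.PP, sub_self] at this
  exact this.symm

theorem RP (x : ℋ) : R E (S.P x) = 0 := by
  have := congrArg (fun f => f (S.P x)) (hR E hE).1
  simp only [ContinuousLinearMap.comp_apply, sub_apply,
    one_apply_eq_self, S.PP, sub_self, map_zero] at this
  exact this.symm

theorem R_mem (x : ℋ) : R E x ∈ S.H.domain := ((hR E hE).2.2 x).1

theorem R_eq (x : ℋ) (h : R E x ∈ S.H.domain) :
    S.H ⟨R E x, h⟩ - S.P (S.H ⟨R E x, h⟩) - (E : ℂ) • R E x = x - S.P x := by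
  obtain ⟨_, h2⟩ := (hR E hE).2.2 x
  simp only [sub_apply,
    one_apply_eq_self, map_sub, map_smul, PR hR hE, sub_zero] at h2
  rw [← h2]

theorem R_eq' (x : ℋ) (h : R E x ∈ S.H.domain) :
    S.H ⟨R E x, h⟩ = x - S.P x + (E : ℂ) • R E x + S.P (S.H ⟨R E x, h⟩) := by
  rw [← R_eq hR hE x h]; abel

theorem inner_R_P (x y : ℋ) : inner ℂ (R E x) (S.P y) = 0 := by
  rw [← P_symm, PR hR hE, inner_zero_left]

theorem inner_P_R (x y : ℋ) : inner ℂ (S.P y) (R E x) = 0 := by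
  rw [P_symm, PR hR hE, inner_zero_right]

theorem R_symm (x y : ℋ) : inner ℂ (R E x) y = inner ℂ x (R E y) := by
  have h := S.symm ⟨_, R_mem hR hE x⟩ ⟨_, R_mem hR hE y⟩
  rw [R_eq' hR hE x, R_eq' hR hE y] at h
  simp only [inner_add_left, inner_add_right, inner_sub_left, inner_sub_right,
    inner_R_P hR hE, inner_P_R hR hE, inner_smul_left, inner_smul_right, Complex.conj_ofReal] at h
  simp only [sub_zero, add_zero] at h
  exact (add_right_cancel h).symm

theorem R_norm : ‖R E‖ ≤ (2 * β - E)⁻¹ := by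
  have hpos : 0 < 2 * β - E := by linarith [hE.2]
  refine ContinuousLinearMap.opNorm_le_bound _ (by positivity) fun x => ?_
  have hl := S.lower ⟨_, R_mem hR hE x⟩
  have hc : S.H ⟨R E x - S.P (R E x), S.H.domain.sub_mem (R_mem hR hE x) (S.memP _)⟩
      = S.H ⟨R E x, R_mem hR hE x⟩ := by
    congr 1; exact Subtype.ext (by simp [PR hR hE])
  simp only [] at hl
  rw [hc] at hl
  simp only [PR hR hE, sub_zero] at hl
  rw [R_eq' hR hE x] at hl
  simp only [inner_add_right, inner_sub_right, inner_R_P hR hE, inner_smul_right, sub_zero,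
    add_zero, inner_self_eq_norm_sq_to_K] at hl
  have hl2 := (Complex.le_def.mp hl).1
  have e : ((E : ℂ) * ((‖R E x‖ : ℝ) : ℂ) ^ 2).re = E * ‖R E x‖ ^ 2 := by
    rw [← Complex.ofReal_pow, ← Complex.ofReal_mul, Complex.ofReal_re]
  simp only [Complex.add_re, Complex.ofReal_re] at hl2
  erw [e] at hl2
  have hcs : (inner ℂ (R E x) x : ℂ).re ≤ ‖R E x‖ * ‖x‖ :=
    (Complex.re_le_norm _).trans (norm_inner_le_norm _ _)
  rw [inv_mul_eq_div, le_div_iff₀ hpos]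
  rcases (norm_nonneg (R E x)).eq_or_lt with h0 | h0
  · rw [← h0]; simp
  · have : ‖R E x‖ * (‖R E x‖ * (2 * β - E)) ≤ ‖R E x‖ * ‖x‖ := by nlinarith
    exact le_of_mul_le_mul_left this h0

theorem R_expand (x : ℋ) : R E x = R 0 x + (E : ℂ) • R 0 (R E x) := by
  have h0 : (0 : ℝ) ∈ Set.Ico 0 (2 * β) := ⟨le_rfl, hE.1.trans_lt hE.2⟩
  have h := (hR 0 h0).2.1 ⟨_, R_mem hR hE x⟩
  have hc : S.H ⟨R E x - S.P (R E x), S.H.domain.sub_mem (R_mem hR hE x) (S.memP _)⟩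
      = S.H ⟨R E x, R_mem hR hE x⟩ := by
    congr 1; exact Subtype.ext (by simp [PR hR hE])
  simp only [] at h
  rw [hc] at h
  simp only [PR hR hE, sub_zero, Complex.ofReal_zero, zero_smul] at h
  rw [R_eq' hR hE x] at h
  simp only [map_add, map_sub, map_smul, sub_apply,
    one_apply_eq_self, RP hR h0, S.PP, PR hR hE] at h
  simp at h
  exact h.symm

theorem PHR (x : ℋ) (h : R E x ∈ S.H.domain) :
    S.P (S.H ⟨R E x, h⟩) = ContinuousLinearMap.adjoint S.A (R E x) := by
  refine ext_inner_left ℂ fun v => ?_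
  rw [← P_symm, ContinuousLinearMap.adjoint_inner_right, A_apply, inner_sub_left,
    inner_P_R hR hE, sub_zero, S.T_eq]
  exact (S.symm ⟨S.P v, S.memP v⟩ ⟨R E x, h⟩).symm

/-- Feshbach: a right inverse of the Schur complement gives invertibility. -/
theorem feshbach (Fi : ℋ →L[ℂ] ℋ) (hP : ∀ x, S.P (Fi x) = Fi x)
    (hF : ∀ x, S.P (S.T (Fi x)) - (E : ℂ) • Fi x
      - ContinuousLinearMap.adjoint S.A (R E (S.A (Fi x))) = S.P x) :
    S.IsInvertibleAt E := by
  set As := ContinuousLinearMap.adjoint S.A with hAs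
  let Q : ℋ →L[ℂ] ℋ := Fi.comp (S.P - As.comp (R E))
  let V : ℋ →L[ℂ] ℋ := Q + (R E).comp (1 - S.A.comp Q)
  have hPAs : ∀ x, S.P (As x) = As x := by
    intro x
    refine ext_inner_left ℂ fun v => ?_
    rw [← P_symm, hAs, ContinuousLinearMap.adjoint_inner_right,
      ContinuousLinearMap.adjoint_inner_right, A_apply, A_apply, TP]
  have hV : ∀ y, ∃ h : V y ∈ S.H.domain, S.H ⟨V y, h⟩ - (E : ℂ) • V y = y := by
    intro y
    set p := Q y with hp
    have hPp : S.P p = p := hP _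
    have hpm : p ∈ S.H.domain := hPp ▸ S.memP p
    set z := y - S.A p with hz
    have hVy : V y = p + R E z := rfl
    have hrm := R_mem hR hE z
    refine ⟨hVy ▸ S.H.domain.add_mem hpm hrm, ?_⟩
    have hHv : ∀ h, S.H ⟨V y, h⟩ = S.T p + S.H ⟨R E z, hrm⟩ := by
      intro h
      have h1 : S.T p = S.H ⟨p, hpm⟩ := by
        rw [S.T_eq]; congr 1; exact Subtype.ext hPp
      rw [h1, ← LinearPMap.map_add]; congr 1
    rw [hHv, hVy, R_eq' hR hE z hrm, PHR hR hE z hrm]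
    have hf := hF ((S.P - As.comp (R E)) y)
    change S.P (S.T p) - (E : ℂ) • p - As (R E (S.A p)) = S.P (S.P y - As (R E y)) at hf
    rw [map_sub, S.PP, hPAs] at hf
    have hAp : S.P (S.A p) = 0 := by rw [A_apply, map_sub, S.PP, sub_self]
    have hTp : S.T p = S.A p + S.P (S.T p) := by rw [A_apply]; abel
    rw [hTp, sub_eq_iff_eq_add.mp hf |> fun h => sub_eq_iff_eq_add.mp h, hz, ← hAs]
    simp only [map_sub, hAp, smul_add, smul_sub]
    abel
  refine ⟨V, fun u => ?_, hV⟩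
  obtain ⟨h, h2⟩ := hV (S.H u - (E : ℂ) • (u : ℋ))
  set v := V (S.H u - (E : ℂ) • (u : ℋ)) with hv
  -- w := v - u is in the kernel
  obtain ⟨h', h3⟩ := hV (v - u)
  set q := V (v - u) with hq
  have hw : S.H (⟨v, h⟩ - u) = (E : ℂ) • (v - (u : ℋ)) := by
    rw [LinearPMap.map_sub, smul_sub, sub_eq_sub_iff_sub_eq_sub]
    rw [sub_eq_iff_eq_add] at h2
    rw [h2]; abel
  have hs := S.symm (⟨v, h⟩ - u) ⟨q, h'⟩
  rw [hw] at hs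
  have : (inner ℂ (v - (u : ℋ)) (v - (u : ℋ)) : ℂ) = 0 := by
    conv_lhs => rw [← h3]
    rw [h3]
    have e : inner ℂ (v - (u : ℋ)) (S.H ⟨q, h'⟩ - (E : ℂ) • q) = 0 := by
      rw [inner_sub_right, inner_smul_right, sub_eq_zero]
      rw [inner_smul_left, Complex.conj_ofReal] at hs
      exact hs.symm
    rwa [h3] at e
  exact sub_eq_zero.mp (inner_self_eq_zero.mp this)

end Res

end FeshbachSetup

namespace FeshbachSetup

variable {ℋ : Type*} [NormedAddCommGroup ℋ] [InnerProductSpace ℂ ℋ] [CompleteSpace ℋ]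
variable {β : ℝ} {S : FeshbachSetup ℋ β}

theorem R_sa {R : ℝ → (ℋ →L[ℂ] ℋ)} (hR : S.IsRedResolvent R) {E : ℝ}
    (hE : E ∈ Set.Ico 0 (2 * β)) : star (R E) = R E := by
  rw [ContinuousLinearMap.star_eq_adjoint]
  refine ContinuousLinearMap.ext fun x => ext_inner_left ℂ fun v => ?_
  rw [ContinuousLinearMap.adjoint_inner_right, R_symm hR hE]

theorem G_norm {R : ℝ → (ℋ →L[ℂ] ℋ)} (hR : S.IsRedResolvent R) {G : ℋ →L[ℂ] ℋ}
    (hG : S.IsYInvSqrt R G) : ‖G‖ ≤ 1 := by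
  obtain ⟨g1, g2, -, g4⟩ := hG
  have h0 : (0 : ℝ) ∈ Set.Ico 0 (2 * β) := ⟨le_rfl, by linarith [S.β_pos]⟩
  refine ContinuousLinearMap.opNorm_le_bound _ zero_le_one fun x => ?_
  have hPG : S.P (G x) = G x := by
    have := congrArg (fun f => S.P (f x)) g1
    simp only [ContinuousLinearMap.comp_apply, S.PP] at this
    rw [← this]
    exact congrArg (fun f => f x) g1
  have h := congrArg (fun f => inner ℂ x (f x)) g4
  simp only [ContinuousLinearMap.comp_apply] at h
  rw [← ContinuousLinearMap.adjoint_inner_left, g2, Y] at h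
  simp only [add_apply, ContinuousLinearMap.comp_apply] at h
  rw [hPG, inner_add_right, ContinuousLinearMap.adjoint_inner_right, ← R_symm hR h0,
    ← S.PP x, ← P_symm, inner_self_eq_norm_sq_to_K, inner_self_eq_norm_sq_to_K,
    inner_self_eq_norm_sq_to_K] at h
  have h' : ‖G x‖ ^ 2 + ‖R 0 (S.A (G x))‖ ^ 2 = ‖S.P x‖ ^ 2 := by exact_mod_cast h
  rw [one_mul]
  refine le_trans ?_ (S.norm_P_le x)
  exact abs_le_of_sq_le_sq' (by nlinarith [sq_nonneg ‖R 0 (S.A (G x))‖]) (norm_nonneg _) |>.2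

theorem gap_single {R : ℝ → (ℋ →L[ℂ] ℋ)} (hR : S.IsRedResolvent R) {G : ℋ →L[ℂ] ℋ}
    (hG : S.IsYInvSqrt R G) {β' D₁ D₂ D E : ℝ} (hD₁ : 0 < D₁) (hD₂ : D₂ < β') (hβ' : β' < β)
    (hgap : Set.Ioo D₁ D₂ ∩ cornerSpec S.P (S.Htilde R G) = ∅)
    (hD0 : 0 ≤ D) (hD : ‖S.T‖ ^ 2 * β' ^ 2 * (β ^ 3)⁻¹ ≤ D)
    (hE : E ∈ Set.Ioo (D₁ + D) (D₂ - D)) : S.IsInvertibleAt E := by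
  have hβ := S.β_pos
  obtain ⟨hE1, hE2⟩ := hE
  have hEm : E ∈ Set.Ico 0 (2 * β) := ⟨by linarith, by linarith⟩
  have h0m : (0 : ℝ) ∈ Set.Ico 0 (2 * β) := ⟨le_rfl, by linarith⟩
  have hGn := G_norm hR hG
  have hinv : ∀ t ∈ Set.Ioo D₁ D₂, ∃ V, IsCornerInv S.P (S.Htilde R G - (t : ℂ) • S.P) V := by
    intro t ht
    by_contra hc
    have : t ∈ Set.Ioo D₁ D₂ ∩ cornerSpec S.P (S.Htilde R G) := ⟨ht, hc⟩
    rw [hgap] at this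
    exact this
  obtain ⟨g1, g2, -, g4⟩ := hG
  rw [← ContinuousLinearMap.star_eq_adjoint] at g2
  have hR0n : ‖R 0‖ ≤ β⁻¹ := (R_norm hR h0m).trans (inv_anti₀ hβ (by linarith))
  have hREn : ‖R E‖ ≤ β⁻¹ := (R_norm hR hEm).trans (inv_anti₀ hβ (by linarith))
  have hR0s := R_sa hR h0m
  have hexp : R E = R 0 + (E : ℂ) • (R 0 * R E) :=
    ContinuousLinearMap.ext fun x => R_expand hR hEm x
  have hAP : S.A * S.P = S.A := ContinuousLinearMap.ext fun x => by
    change S.A (S.P x) = S.A x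
    rw [A_apply, A_apply, TP]
  have hPs : star S.P = S.P := S.P_sa
  have hPAs : S.P * star S.A = star S.A := by
    conv_rhs => rw [← hAP, star_mul, hPs]
  have hPTs : star (S.P * S.T) = S.P * S.T := by
    rw [ContinuousLinearMap.star_eq_adjoint]
    refine ContinuousLinearMap.ext fun x => ext_inner_left ℂ fun v => ?_
    rw [ContinuousLinearMap.adjoint_inner_right]
    exact S.PT_symm v x
  have hPP : S.P * S.P = S.P := S.P_idem
  have hY : G * (S.P + star S.A * (R 0 * (R 0 * S.A))) * G = S.P := by
    rw [mul_assoc]; exact g4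
  have hHt : S.Htilde R G = G * (S.P * S.T - star S.A * (R 0 * S.A)) * G := by
    rw [mul_assoc]; rfl
  have g1' : S.P * (G * S.P) = G := g1
  have hPG : S.P * G = G := by rw [← g1', ← mul_assoc S.P S.P, hPP]
  have hGP : G * S.P = G := by rw [← g1', mul_assoc, mul_assoc, hPP]
  have hAn := S.norm_A_le
  have hHts : star (S.Htilde R G) = S.Htilde R G := by
    rw [hHt]
    simp only [star_mul, star_sub, star_star, hR0s, g2] at hPTs ⊢
    rw [hPTs]; simp only [mul_assoc]
  have hFes := fun Fi => feshbach hR hEm Fi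
  obtain ⟨V, v1, v2, v3⟩ := hinv E ⟨by linarith, by linarith⟩
  have hPHt : S.P * S.Htilde R G = S.Htilde R G := by
    rw [hHt, ← mul_assoc, ← mul_assoc, hPG]
  have hHtP : S.Htilde R G * S.P = S.Htilde R G := by
    rw [hHt, mul_assoc _ G, hGP]
  set W := S.Htilde R G - (E : ℂ) • S.P with hW
  have hPW : S.P * W = W := by rw [hW, mul_sub, hPHt, mul_smul_comm, hPP]
  have hWP : W * S.P = W := by rw [hW, sub_mul, hHtP, smul_mul_assoc, hPP]
  have corner : ∀ V : ℋ →L[ℂ] ℋ, S.P.comp (V.comp S.P) = V → S.P * V = V ∧ V * S.P = V := by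
    intro V hV
    have hV' : S.P * (V * S.P) = V := hV
    constructor
    · rw [← hV', ← mul_assoc S.P S.P, hPP]
    · rw [← hV', mul_assoc, mul_assoc, hPP]
  obtain ⟨hPV, hVP⟩ := corner V v1
  have hVW : V * W = S.P := v2
  have hWV : W * V = S.P := v3
  have hWs : star W = W := by
    rw [hW, star_sub, hHts, star_smul, hPs]; simp
  have hVs : IsSelfAdjoint V := by
    have h1 : star V * W = S.P := by
      rw [← hWs, ← star_mul, hWV, hPs]
    have h2 : star V * S.P = star V := by
      conv_lhs => rw [← hPs]
      rw [← star_mul, hPV]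
    change star V = V
    rw [← h2, ← hWV, ← mul_assoc, h1, hPV]
  obtain ⟨δ, hδD, hδ1, hδ2⟩ : ∃ δ, D < δ ∧ δ ≤ E - D₁ ∧ δ ≤ D₂ - E :=
    ⟨min (E - D₁) (D₂ - E), lt_min (by linarith) (by linarith), min_le_left _ _, min_le_right _ _⟩
  have hδ : 0 < δ := lt_of_le_of_lt hD0 hδD
  have hVn : ‖V‖ ≤ δ⁻¹ := by
    refine corner_norm_le hδ hVW hWV hVP hVs fun t ht => ?_
    obtain ⟨ht1, ht2⟩ := abs_lt.mp ht
    obtain ⟨V', w1, w2, w3⟩ := hinv (E + t) ⟨by linarith, by linarith⟩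
    obtain ⟨c1, c2⟩ := corner V' w1
    have : W - (t : ℂ) • S.P = S.Htilde R G - ((E + t : ℝ) : ℂ) • S.P := by
      rw [hW]; push_cast; module
    rw [this]
    exact ⟨V', c1, c2, w2, w3⟩
  set K := ((E : ℂ) ^ 2) • (G * (star S.A * (R 0 * (R 0 * (R E * S.A)))) * G) with hK
  have hPK : S.P * K = K := by
    rw [hK, mul_smul_comm, ← mul_assoc, ← mul_assoc, hPG]
  have hAsn : ‖star S.A‖ ≤ ‖S.T‖ := by rw [norm_star]; exact hAn
  have hKn : ‖K‖ ≤ D := by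
    refine le_trans ?_ hD
    have hb : 0 ≤ β⁻¹ := by positivity
    have e1 : ‖G * (star S.A * (R 0 * (R 0 * (R E * S.A)))) * G‖
        ≤ 1 * (‖S.T‖ * (β⁻¹ * (β⁻¹ * (β⁻¹ * ‖S.T‖)))) * 1 := by
      refine norm_mul_le_of_le (norm_mul_le_of_le hGn ?_) hGn
      refine norm_mul_le_of_le hAsn (norm_mul_le_of_le hR0n (norm_mul_le_of_le hR0n
        (norm_mul_le_of_le hREn hAn)))
    have e2 : ‖(E : ℂ) ^ 2‖ ≤ β' ^ 2 := by
      rw [norm_pow, Complex.norm_real, Real.norm_eq_abs, sq_abs]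
      have : 0 ≤ E := hEm.1
      gcongr; linarith
    rw [hK, norm_smul]
    calc _ ≤ β' ^ 2 * (1 * (‖S.T‖ * (β⁻¹ * (β⁻¹ * (β⁻¹ * ‖S.T‖)))) * 1) := by gcongr
      _ = _ := by rw [inv_pow _ _ |>.symm]; ring
  have hKV : ‖K * V‖ < 1 := by
    refine (norm_mul_le_of_le hKn hVn).trans_lt ?_
    rw [← div_eq_mul_inv, div_lt_one hδ]; exact hδD
  obtain ⟨N, hN⟩ := (isUnit_one_sub_of_norm_lt_one hKV).exists_right_inv
  have hX : (W - K) * (V * N) = S.P := by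
    have : (W - K) * V = S.P * (1 - K * V) := by
      rw [sub_mul, hWV, mul_sub, mul_one, ← mul_assoc, hPK]
    rw [← mul_assoc, this, mul_assoc, hN, mul_one]
  set F := S.P * S.T - (E : ℂ) • S.P - star S.A * (R E * S.A) with hF
  have hexp2 : R E = R 0 + (E : ℂ) • (R 0 * R 0) + ((E : ℂ) ^ 2) • (R 0 * (R 0 * R E)) := by
    conv_lhs => rw [hexp, hexp]
    simp only [mul_add, mul_smul_comm, smul_add, smul_smul, sq, add_assoc]
  have hGFG : G * F * G = W - K := by
    have : F = (S.P * S.T - star S.A * (R 0 * S.A))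
        - (E : ℂ) • (S.P + star S.A * (R 0 * (R 0 * S.A)))
        - ((E : ℂ) ^ 2) • (star S.A * (R 0 * (R 0 * (R E * S.A)))) := by
      rw [hF]
      conv_lhs => rw [hexp2]
      simp only [mul_add, add_mul, mul_smul_comm, smul_mul_assoc, mul_assoc]
      module
    rw [this, hW, hHt, hK]
    simp only [mul_sub (G), sub_mul _ _ G, mul_smul_comm, smul_mul_assoc, hY]
  have hPF : S.P * F = F := by
    rw [hF]
    simp only [mul_sub, mul_smul_comm, ← mul_assoc, hPP, hPAs]
  set J := G * (S.P + star S.A * (R 0 * (R 0 * S.A))) with hJ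
  have hFFi : F * (G * (V * N) * G) = S.P := by
    calc F * (G * (V * N) * G) = J * ((G * F * G) * (V * N)) * G := by
          conv_lhs => rw [← hPF, ← hY]
          simp only [mul_assoc]
      _ = J * G := by rw [hGFG, hX, mul_assoc, hPG]
      _ = S.P := hY
  refine hFes (G * (V * N) * G) (fun x => ?_) (fun x => ?_)
  · have : S.P * (G * (V * N) * G) = G * (V * N) * G := by
      rw [← mul_assoc, ← mul_assoc, hPG]
    exact congrArg (fun f => f x) this
  · have h1 : S.P * (G * (V * N) * G) = G * (V * N) * G := by
      rw [← mul_assoc, ← mul_assoc, hPG]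
    have h2 := congrArg (fun f => f x) hFFi
    have h3 := congrArg (fun f => f x) h1
    set Fi := G * (V * N) * G
    rw [← h2]
    change _ = S.P (S.T (Fi x)) - (E : ℂ) • S.P (Fi x) - (star S.A) (R E (S.A (Fi x)))
    change S.P (Fi x) = Fi x at h3
    rw [h3]; rfl

end FeshbachSetup

/-- Family version: if `(D₁, D₂)` is disjoint from `σ(H̃(η))` for all `η ∈ [0, ε₁]` and
`D := (sup_η ‖H(η)Π(η)‖²)(β')²β⁻³ < (D₂ - D₁)/2`, then `(D₁ + D, D₂ - D)` is disjoint
from `σ(H(η))` for every `η ∈ [0, ε₁]`. -/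
theorem gap_in_spec_family {ℋ : Type*} [NormedAddCommGroup ℋ] [InnerProductSpace ℂ ℋ]
    [CompleteSpace ℋ] {β ε₁ : ℝ} (hε₁ : 0 < ε₁)
    (S : ℝ → FeshbachSetup ℋ β)
    (R : ℝ → ℝ → (ℋ →L[ℂ] ℋ)) (hR : ∀ η ∈ Set.Icc (0 : ℝ) ε₁, (S η).IsRedResolvent (R η))
    (G : ℝ → (ℋ →L[ℂ] ℋ)) (hG : ∀ η ∈ Set.Icc (0 : ℝ) ε₁, (S η).IsYInvSqrt (R η) (G η))
    (hbdd : BddAbove ((fun η => ‖(S η).T‖ ^ 2) '' Set.Icc 0 ε₁))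
    {β' D₁ D₂ D : ℝ} (hD₁ : 0 < D₁) (h₁₂ : D₁ < D₂) (hD₂ : D₂ < β') (hβ' : β' < β)
    (hgap : ∀ η ∈ Set.Icc (0 : ℝ) ε₁,
      Set.Ioo D₁ D₂ ∩ cornerSpec (S η).P ((S η).Htilde (R η) (G η)) = ∅)
    (hD : D = sSup ((fun η => ‖(S η).T‖ ^ 2) '' Set.Icc 0 ε₁) * β' ^ 2 * (β ^ 3)⁻¹)
    (hsmall : D < (D₂ - D₁) / 2) :
    ∀ η ∈ Set.Icc (0 : ℝ) ε₁, Set.Ioo (D₁ + D) (D₂ - D) ∩ (S η).spec = ∅ := by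
  intro η hη
  have hβ := (S η).β_pos
  have hle : ‖(S η).T‖ ^ 2 ≤ sSup ((fun η => ‖(S η).T‖ ^ 2) '' Set.Icc 0 ε₁) :=
    le_csSup hbdd ⟨η, hη, rfl⟩
  have h1 : ‖(S η).T‖ ^ 2 * β' ^ 2 * (β ^ 3)⁻¹ ≤ D := by
    rw [hD]; gcongr
  have h0 : 0 ≤ D := le_trans (by positivity) h1
  rw [Set.eq_empty_iff_forall_notMem]
  rintro E ⟨hE, hs⟩
  exact hs (FeshbachSetup.gap_single (hR η hη) (hG η hη) hD₁ hD₂ hβ' (hgap η hη) h0 h1 hE)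
end
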